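/- Let β = 0, 0 < α < 8/(d+n), and let u_λ be a minimizer of m_{1,λ} = inf{E_λ(u) : u ∈ S(1)} where E_λ(u) = (λ/2)‖Δ_y u‖₂² + ½‖Δ_x u‖₂² - (1/(α+2))‖u‖_{α+2}^{α+2}. Then ‖Δ_y u_λ‖₂² → 0 as λ → ∞. -/

import Mathlib

noncomputable section

open MeasureTheory Real Filter Set

namespace BNLS

/-- A point of `ℝ^d × 𝕋^n`, the torus being modelled by periodic functions on `ℝ^n`. -/
abbrev Pt (d n : ℕ) := (Fin d → ℝ) × (Fin n → ℝ)

/-- Fundamental domain `[0,2π)^n` of the torus `(ℝ/2πℤ)^n`. -/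
def torusBox (n : ℕ) : Set (Fin n → ℝ) := Set.univ.pi fun _ => Set.Ico 0 (2*π)

/-- The measure of the torus `𝕋^n`. -/
def μT (n : ℕ) : Measure (Fin n → ℝ) := volume.restrict (torusBox n)

/-- The measure of `ℝ^d × 𝕋^n`. -/
def μP (d n : ℕ) : Measure (Pt d n) := (volume : Measure (Fin d → ℝ)).prod (μT n)

/-- Partial derivative in the `i`-th `x`-direction. -/
def dX (d n : ℕ) (i : Fin d) (u : Pt d n → ℂ) : Pt d n → ℂ :=
  fun p => fderiv ℝ u p (Pi.single i 1, 0)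

/-- Partial derivative in the `j`-th `y`-direction. -/
def dY (d n : ℕ) (j : Fin n) (u : Pt d n → ℂ) : Pt d n → ℂ :=
  fun p => fderiv ℝ u p (0, Pi.single j 1)

/-- Partial Laplacian `Δ_x`. -/
def lapX (d n : ℕ) (u : Pt d n → ℂ) : Pt d n → ℂ := fun p => ∑ i, dX d n i (dX d n i u) p

/-- Partial Laplacian `Δ_y`. -/
def lapY (d n : ℕ) (u : Pt d n → ℂ) : Pt d n → ℂ := fun p => ∑ j, dY d n j (dY d n j u) p

/-- Full Laplacian `Δ_{x,y}`. -/
def lap (d n : ℕ) (u : Pt d n → ℂ) : Pt d n → ℂ := fun p => lapX d n u p + lapY d n u p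

/-- Mass `‖u‖_{L²}²`. -/
def Mass (d n : ℕ) (u : Pt d n → ℂ) : ℝ := ∫ z, ‖u z‖^2 ∂(μP d n)

/-- `‖u‖_{L^p}^p`. -/
def Npow (d n : ℕ) (p : ℝ) (u : Pt d n → ℂ) : ℝ := ∫ z, ‖u z‖ ^ p ∂(μP d n)

/-- The `L^p` norm. -/
def LpN (d n : ℕ) (p : ℝ) (u : Pt d n → ℂ) : ℝ := (Npow d n p u) ^ (1/p)

/-- `‖Δ u‖_{L²}²`. -/
def lapSq (d n : ℕ) (u : Pt d n → ℂ) : ℝ := ∫ z, ‖lap d n u z‖^2 ∂(μP d n)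

/-- `‖Δ_x u‖_{L²}²`. -/
def lapXSq (d n : ℕ) (u : Pt d n → ℂ) : ℝ := ∫ z, ‖lapX d n u z‖^2 ∂(μP d n)

/-- `‖Δ_y u‖_{L²}²`. -/
def lapYSq (d n : ℕ) (u : Pt d n → ℂ) : ℝ := ∫ z, ‖lapY d n u z‖^2 ∂(μP d n)

/-- `‖∇_x u‖_{L²}²`. -/
def gradXSq (d n : ℕ) (u : Pt d n → ℂ) : ℝ := ∫ z, (∑ i, ‖dX d n i u z‖^2) ∂(μP d n)

/-- `‖∇_y u‖_{L²}²`. -/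
def gradYSq (d n : ℕ) (u : Pt d n → ℂ) : ℝ := ∫ z, (∑ j, ‖dY d n j u z‖^2) ∂(μP d n)

/-- `‖∇ u‖_{L²}²`. -/
def gradSq (d n : ℕ) (u : Pt d n → ℂ) : ℝ := gradXSq d n u + gradYSq d n u

/-- Pointwise sum of squares of all second derivatives. -/
def hessInt (d n : ℕ) (u : Pt d n → ℂ) (z : Pt d n) : ℝ :=
  (∑ i, ∑ i', ‖dX d n i (dX d n i' u) z‖^2) + (∑ i, ∑ j, ‖dY d n j (dX d n i u) z‖^2)
  + (∑ j, ∑ i, ‖dX d n i (dY d n j u) z‖^2) + (∑ j, ∑ j', ‖dY d n j (dY d n j' u) z‖^2)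

/-- `‖∇² u‖_{L²}²`. -/
def hessSq (d n : ℕ) (u : Pt d n → ℂ) : ℝ := ∫ z, hessInt d n u z ∂(μP d n)

/-- The `H²` norm on `ℝ^d × 𝕋^n`. -/
def H2norm (d n : ℕ) (u : Pt d n → ℂ) : ℝ :=
  Real.sqrt (Mass d n u + gradSq d n u + hessSq d n u)

/-- `2π`-periodicity in all `y`-variables. -/
def Periodic (d n : ℕ) (u : Pt d n → ℂ) : Prop :=
  ∀ j : Fin n, ∀ p : Pt d n, u (p.1, p.2 + (2*π) • (Pi.single j 1 : Fin n → ℝ)) = u p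

/-- Membership in `H²(ℝ^d × 𝕋^n)`. -/
def InH2 (d n : ℕ) (u : Pt d n → ℂ) : Prop :=
  ContDiff ℝ 2 u ∧ Periodic d n u ∧
  Integrable (fun z => ‖u z‖^2) (μP d n) ∧
  Integrable (fun z => (∑ i, ‖dX d n i u z‖^2) + ∑ j, ‖dY d n j u z‖^2) (μP d n) ∧
  Integrable (hessInt d n u) (μP d n)

/-- The mass sphere `S(c)`. -/
def Sset (d n : ℕ) (c : ℝ) : Set (Pt d n → ℂ) := {u | InH2 d n u ∧ Mass d n u = c}

/-- The energy functional `E`. -/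
def En (d n : ℕ) (β α : ℝ) (u : Pt d n → ℂ) : ℝ :=
  (1/2) * lapSq d n u + (β/2) * gradSq d n u - (1/(α+2)) * Npow d n (α+2) u

/-- The ground state energy `m_c`. -/
def mC (d n : ℕ) (β α c : ℝ) : ℝ := sInf (En d n β α '' Sset d n c)

end BNLS

namespace BNLS

/-- The rescaled energy `E_λ` (case `β = 0`). -/
def Elam (d n : ℕ) (lam α : ℝ) (u : Pt d n → ℂ) : ℝ :=
  (lam/2) * lapYSq d n u + (1/2) * lapXSq d n u - (1/(α+2)) * Npow d n (α+2) u

/-- The rescaled ground state energy `m_{1,λ}`. -/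
def m1lam (d n : ℕ) (lam α : ℝ) : ℝ := sInf (Elam d n lam α '' Sset d n 1)

end BNLS

namespace BNLS

open scoped ENNReal Topology Pointwise

/-- Periodicity for functions with arbitrary codomain. -/
def Per {d n : ℕ} {X : Type*} (F : Pt d n → X) : Prop :=
  ∀ j : Fin n, ∀ p : Pt d n, F (p.1, p.2 + (2*π) • (Pi.single j 1 : Fin n → ℝ)) = F p

instance instSFiniteT (n : ℕ) : SFinite (μT n) := by unfold μT; infer_instance
instance instSFiniteP (d n : ℕ) : SFinite (μP d n) := by unfold μP; infer_instance

lemma torus_fd (n : ℕ) : ∃ b : Module.Basis (Fin n) ℝ (Fin n → ℝ),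
    (∀ j, b j = (2*π) • (Pi.single j 1 : Fin n → ℝ)) ∧ torusBox n = ZSpan.fundamentalDomain b := by
  have h0 : (2*π) ≠ 0 := by positivity
  have h1 : 0 < 2*π := by positivity
  let b := (Pi.basisFun ℝ (Fin n)).unitsSMul (fun _ => Units.mk0 (2*π) h0)
  refine ⟨b, fun j => ?_, ?_⟩
  · simp [b, Module.Basis.unitsSMul_apply, Units.smul_def]
  · ext x
    simp only [torusBox, Set.mem_pi, Set.mem_univ, true_imp_iff, ZSpan.mem_fundamentalDomain, b]
    refine forall_congr' fun i => ?_
    rw [Module.Basis.repr_unitsSMul]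
    simp only [Pi.basisFun_repr, Units.smul_def, Units.val_inv_eq_inv_val, Units.val_mk0,
      smul_eq_mul, Set.mem_Ico]
    rw [inv_mul_lt_iff₀ h1, mul_one]
    refine and_congr ?_ Iff.rfl
    constructor
    · intro h; positivity
    · intro h
      by_contra hx
      push Not at hx
      have := mul_neg_of_pos_of_neg (inv_pos.2 h1) hx
      linarith

lemma torus_shift (n : ℕ) (F : (Fin n → ℝ) → ℝ≥0∞)
    (hF : ∀ j x, F (x + (2*π) • (Pi.single j 1 : Fin n → ℝ)) = F x) (w : Fin n → ℝ) :
    ∫⁻ y, F (y + w) ∂(μT n) = ∫⁻ y, F y ∂(μT n) := by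
  obtain ⟨b, hb, hbox⟩ := torus_fd n
  have fd := ZSpan.isAddFundamentalDomain' b (volume : Measure (Fin n → ℝ))
  rw [← hbox] at fd
  have hinv : ∀ g ∈ Submodule.span ℤ (Set.range b), ∀ x, F (g + x) = F x := by
    intro g hg
    induction hg using Submodule.span_induction with
    | mem x hx =>
      obtain ⟨j, rfl⟩ := hx
      intro x; rw [hb, add_comm]; exact hF j x
    | zero => simp
    | add x y _ _ hx hy => intro z; rw [add_assoc, hx, hy]
    | smul a x _ hx =>
      intro z
      have hneg : ∀ z, F (-x + z) = F z := fun z => by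
        rw [← hx (-x + z), add_neg_cancel_left]
      have hnat : ∀ k : ℕ, ∀ z, F ((k:ℤ) • x + z) = F z := by
        intro k
        induction k with
        | zero => simp
        | succ k ih => 
          intro z; push_cast; rw [add_smul, one_smul, add_assoc, ih, hx]
      have hnat' : ∀ k : ℕ, ∀ z, F (-(k:ℤ) • x + z) = F z := by
        intro k
        induction k with
        | zero => simp
        | succ k ih => 
          intro z; push_cast; rw [neg_add, add_smul, neg_smul 1 x, one_smul, add_assoc, ih, hneg]
      rcases Int.eq_nat_or_neg a with ⟨k, rfl | rfl⟩
      · exact hnat k z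
      · exact hnat' k z
  have fd2 : IsAddFundamentalDomain (Submodule.span ℤ (Set.range b)).toAddSubgroup
      (w +ᵥ torusBox n) volume := fd.vadd_of_comm w
  have : Countable (Submodule.span ℤ (Set.range b)).toAddSubgroup :=
    inferInstanceAs (Countable (Submodule.span ℤ (Set.range b)))
  have key := fd2.setLIntegral_eq fd F (fun g x => hinv g.1 g.2 x)
  unfold μT
  rw [← key]
  have := (measurePreserving_add_right (volume : Measure (Fin n → ℝ)) w).setLIntegral_comp_emb
    (measurableEmbedding_addRight w) F (torusBox n)
  refine this.trans ?_
  congr 2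
  ext x
  simp only [Set.mem_image, Set.mem_vadd_set, vadd_eq_add, add_comm]

lemma shift {d n : ℕ} {F : Pt d n → ℝ≥0∞} (hm : Measurable F) (hF : Per F) (w : Pt d n) :
    ∫⁻ z, F (z + w) ∂(μP d n) = ∫⁻ z, F z ∂(μP d n) := by
  unfold μP
  rw [lintegral_prod _ (by fun_prop), lintegral_prod _ (by fun_prop)]
  have : ∀ x : Fin d → ℝ, ∫⁻ y, F ((x, y) + w) ∂(μT n) = ∫⁻ y, F (x + w.1, y) ∂(μT n) := by
    intro x
    exact torus_shift n (fun y => F (x + w.1, y)) (fun j y => hF j (x + w.1, y)) w.2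
  simp_rw [this]
  exact lintegral_add_right_eq_self (fun x => ∫⁻ y, F (x, y) ∂(μT n)) w.1

/-- squared L2 norm -/
def L {d n : ℕ} (f : Pt d n → ℂ) : ℝ≥0∞ := ∫⁻ z, ‖f z‖ₑ ^ 2 ∂(μP d n)

lemma L_shift {d n : ℕ} {f : Pt d n → ℂ} (hf : Continuous f) (hp : Per f) (w : Pt d n) :
    L (fun z => f (z + w)) = L f := by
  unfold L
  exact shift (F := fun z => ‖f z‖ₑ ^ 2) (by fun_prop) (fun j p => by simp only [hp j p]) w

lemma jensen_sq {Ω : Type*} [MeasurableSpace Ω] (ν : Measure Ω) [IsProbabilityMeasure ν]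
    (g : Ω → ℂ) (hg : AEStronglyMeasurable g ν) :
    ‖∫ t, g t ∂ν‖ₑ ^ 2 ≤ ∫⁻ t, ‖g t‖ₑ ^ 2 ∂ν := by
  have h1 : ‖∫ t, g t ∂ν‖ₑ ≤ eLpNorm g 1 ν := by
    rw [eLpNorm_one_eq_lintegral_enorm]; exact enorm_integral_le_lintegral_enorm g
  have h2 : eLpNorm g 1 ν ≤ eLpNorm g 2 ν :=
    eLpNorm_le_eLpNorm_of_exponent_le (by norm_num) hg
  calc _ ≤ (eLpNorm g 2 ν) ^ 2 := by gcongr; exact h1.trans h2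
    _ = _ := by
      rw [eLpNorm_eq_lintegral_rpow_enorm_toReal (by norm_num) (by norm_num)]
      simp only [ENNReal.toReal_ofNat, one_div]
      rw [← ENNReal.rpow_natCast, ← ENNReal.rpow_mul]
      norm_num

lemma jensen {d n : ℕ} {Ω : Type*} [MeasurableSpace Ω] (ν : Measure Ω) [IsProbabilityMeasure ν]
    (g : Pt d n → Ω → ℂ) (hg : StronglyMeasurable (Function.uncurry g)) (C : ℝ≥0∞)
    (hC : ∀ᵐ t ∂ν, L (fun z => g z t) ≤ C) :
    L (fun z => ∫ t, g z t ∂ν) ≤ C := by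
  have hm : Measurable (Function.uncurry (fun z t => ‖g z t‖ₑ ^ 2)) := by
    have := hg.measurable
    exact (this.enorm).pow_const 2
  calc L (fun z => ∫ t, g z t ∂ν) ≤ ∫⁻ z, ∫⁻ t, ‖g z t‖ₑ ^ 2 ∂ν ∂(μP d n) := by
        unfold L
        refine lintegral_mono fun z => jensen_sq ν _ ?_
        exact (hg.comp_measurable measurable_prodMk_left).aestronglyMeasurable
    _ = ∫⁻ t, ∫⁻ z, ‖g z t‖ₑ ^ 2 ∂(μP d n) ∂ν := lintegral_lintegral_swap hm.aemeasurable
    _ ≤ ∫⁻ t, C ∂ν := lintegral_mono_ae hC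
    _ = C := by simp

/-- Directional derivative -/
def pd {d n : ℕ} (a : Pt d n) (u : Pt d n → ℂ) : Pt d n → ℂ := fun z => fderiv ℝ u z a

/-- forward difference -/
def D {d n : ℕ} (a : Pt d n) (u : Pt d n → ℂ) : Pt d n → ℂ := fun z => u (z + a) - u z

/-- segment average -/
def Av {d n : ℕ} (a : Pt d n) (u : Pt d n → ℂ) : Pt d n → ℂ :=
  fun z => ∫ t in (0:ℝ)..1, u (z + t • a)

variable {d n : ℕ}

lemma Per.pd {u : Pt d n → ℂ} (hu : Per u) (a : Pt d n) : Per (pd a u) := by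
  intro j p
  unfold BNLS.pd
  have h : (fun z : Pt d n => u (z + (0, (2*π) • (Pi.single j 1 : Fin n → ℝ)))) = u := by
    funext z
    have := hu j z
    rw [← this]; congr 1; ext <;> simp
  have e : ((p.1, p.2 + (2*π) • (Pi.single j 1 : Fin n → ℝ)) : Pt d n)
      = p + (0, (2*π) • (Pi.single j 1 : Fin n → ℝ)) := by ext <;> simp
  rw [e, ← fderiv_comp_add_right, h]

lemma Per.shift {u : Pt d n → ℂ} (hu : Per u) (a : Pt d n) : Per (fun z => u (z + a)) := by
  intro j p
  have := hu j (p + a)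
  simp only
  rw [← this]
  congr 1; ext <;> simp; ring

lemma Per.D {u : Pt d n → ℂ} (hu : Per u) (a : Pt d n) : Per (D a u) := by
  intro j p
  unfold BNLS.D
  have h1 := hu.shift a j p
  simp only at h1
  rw [h1, hu j p]

lemma Per.Av {u : Pt d n → ℂ} (hu : Per u) (a : Pt d n) : Per (Av a u) := by
  intro j p
  unfold BNLS.Av
  congr 1
  funext t
  exact hu.shift (t • a) j p

lemma Av_cont {u : Pt d n → ℂ} (hu : Continuous u) (a : Pt d n) : Continuous (Av a u) := by
  unfold Av
  exact intervalIntegral.continuous_parametric_intervalIntegral_of_continuous' (by fun_prop) 0 1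

lemma L_Av {u : Pt d n → ℂ} (hu : Continuous u) (hp : Per u) (a : Pt d n) :
    L (Av a u) ≤ L u := by
  have : Av a u = fun z => ∫ t, u (z + t • a) ∂(volume.restrict (Set.Ioc (0:ℝ) 1)) := by
    funext z; unfold Av; rw [intervalIntegral.integral_of_le (by norm_num)]
  rw [this]
  have : IsProbabilityMeasure (volume.restrict (Set.Ioc (0:ℝ) 1)) := ⟨by simp⟩
  apply jensen
  · apply Continuous.stronglyMeasurable; unfold Function.uncurry; fun_prop
  · exact .of_forall fun t => (L_shift hu hp _).le

lemma D_eq {u : Pt d n → ℂ} (hu : ContDiff ℝ 1 u) (a : Pt d n) : D a u = Av a (pd a u) := by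
  funext z
  have hd : ∀ t : ℝ, HasDerivAt (fun t : ℝ => u (z + t • a)) (pd a u (z + t • a)) t := by
    intro t
    have h1 : HasDerivAt (fun t : ℝ => z + t • a) a t := by
      simpa using ((hasDerivAt_id t).smul_const a).const_add z
    exact ((hu.differentiable (by norm_num) _).hasFDerivAt).comp_hasDerivAt t h1
  have hc : Continuous (pd a u) := by
    unfold pd; exact (hu.continuous_fderiv (by norm_num)).clm_apply continuous_const
  unfold Av D
  rw [intervalIntegral.integral_eq_sub_of_hasDerivAt (fun t _ => hd t)
    (Continuous.intervalIntegrable (by fun_prop) _ _)]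
  simp

lemma pd_contDiff {u : Pt d n → ℂ} (hu : ContDiff ℝ 2 u) (a : Pt d n) : ContDiff ℝ 1 (pd a u) := by
  unfold pd
  exact (hu.fderiv_right (m := 1) (by norm_num)).clm_apply contDiff_const

lemma pd_cont {u : Pt d n → ℂ} (hu : ContDiff ℝ 1 u) (a : Pt d n) : Continuous (pd a u) := by
  unfold pd
  exact (hu.continuous_fderiv (by norm_num)).clm_apply continuous_const

lemma D_contDiff {u : Pt d n → ℂ} {k} (hu : ContDiff ℝ k u) (a : Pt d n) : ContDiff ℝ k (D a u) := by
  unfold D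
  exact (hu.comp (contDiff_id.add contDiff_const)).sub hu

lemma pd_D {u : Pt d n → ℂ} (hu : ContDiff ℝ 1 u) (a b : Pt d n) : pd a (D b u) = D b (pd a u) := by
  funext z
  unfold pd D
  have hd := hu.differentiable (by norm_num)
  have h1 : DifferentiableAt ℝ (fun z => u (z + b)) z := (hd _).comp z (by fun_prop)
  rw [fderiv_fun_sub h1 (hd _), fderiv_comp_add_right]
  rfl

lemma DD_eq {u : Pt d n → ℂ} (hu : ContDiff ℝ 2 u) (a b : Pt d n) :
    D a (D b u) = Av a (Av b (pd b (pd a u))) := by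
  have hu1 : ContDiff ℝ 1 u := hu.of_le (by norm_num)
  rw [D_eq (D_contDiff hu1 b) a, pd_D hu1, D_eq (pd_contDiff hu a)]

lemma L_DD {u : Pt d n → ℂ} (hu : ContDiff ℝ 2 u) (hp : Per u) (a b : Pt d n) :
    L (D a (D b u)) ≤ L (pd b (pd a u)) := by
  rw [DD_eq hu]
  have hc := pd_cont (pd_contDiff hu a) b
  have hpp := (hp.pd a).pd b
  exact (L_Av (Av_cont hc b) (hpp.Av b) a).trans (L_Av hc hpp b)

end BNLS

namespace BNLS

open scoped ENNReal Topology Pointwise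

variable {d n : ℕ}

/-- Continuous periodic functions of finite L2 norm. -/
structure Good (f : Pt d n → ℂ) : Prop where
  cont : Continuous f
  per : Per f
  fin : L f < ⊤

lemma Good.memLp {f : Pt d n → ℂ} (hf : Good f) : MemLp f 2 (μP d n) := by
  refine ⟨hf.cont.aestronglyMeasurable, ?_⟩
  rw [eLpNorm_lt_top_iff_lintegral_rpow_enorm_lt_top (by norm_num) (by norm_num)]
  have := hf.fin
  unfold L at this
  simpa using this

/-- real inner product -/
def ip (f g : Pt d n → ℂ) : ℝ := ∫ z, inner ℝ (f z) (g z) ∂(μP d n)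

lemma Good.int {f g : Pt d n → ℂ} (hf : Good f) (hg : Good g) :
    Integrable (fun z => inner ℝ (f z) (g z)) (μP d n) := by
  have h := hf.memLp.norm.integrable_mul hg.memLp.norm
  refine h.mono' (hf.cont.inner hg.cont).aestronglyMeasurable (.of_forall fun z => ?_)
  exact norm_inner_le_norm (𝕜 := ℝ) _ _

lemma L_eq {f : Pt d n → ℂ} (hf : Good f) : L f = ENNReal.ofReal (ip f f) := by
  unfold L ip
  rw [ofReal_integral_eq_lintegral_ofReal (hf.int hf)]
  · congr 1; funext z
    rw [real_inner_self_eq_norm_sq, ENNReal.ofReal_pow (norm_nonneg _), ofReal_norm]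
  · exact .of_forall fun _ => real_inner_self_nonneg

lemma ip_self_nonneg (f : Pt d n → ℂ) : 0 ≤ ip f f :=
  integral_nonneg fun _ => real_inner_self_nonneg

lemma ip_comm (f g : Pt d n → ℂ) : ip f g = ip g f := by
  unfold ip; congr 1; funext z; exact real_inner_comm _ _

lemma Good.of_memLp {f : Pt d n → ℂ} (hc : Continuous f) (hp : Per f) (h : MemLp f 2 (μP d n)) :
    Good f := by
  refine ⟨hc, hp, ?_⟩
  have := h.2
  rw [eLpNorm_lt_top_iff_lintegral_rpow_enorm_lt_top (by norm_num) (by norm_num)] at this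
  unfold L
  simpa using this

lemma Good.sub {f g : Pt d n → ℂ} (hf : Good f) (hg : Good g) : Good (fun z => f z - g z) :=
  .of_memLp (hf.cont.sub hg.cont) (fun j p => by simp only [hf.per j p, hg.per j p])
    (hf.memLp.sub hg.memLp)

lemma Good.smul {f : Pt d n → ℂ} (hf : Good f) (c : ℝ) : Good (fun z => c • f z) :=
  .of_memLp (hf.cont.const_smul c) (fun j p => by simp only [hf.per j p])
    (hf.memLp.const_smul c)

lemma Good.shift {f : Pt d n → ℂ} (hf : Good f) (a : Pt d n) : Good (fun z => f (z + a)) :=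
  ⟨hf.cont.comp (by fun_prop), hf.per.shift a, by rw [L_shift hf.cont hf.per]; exact hf.fin⟩

lemma Good.D {f : Pt d n → ℂ} (hf : Good f) (a : Pt d n) : Good (D a f) :=
  (hf.shift a).sub hf

lemma Good.sum {ι : Type*} (s : Finset ι) {f : ι → Pt d n → ℂ} (hf : ∀ i, Good (f i)) :
    Good (fun z => ∑ i ∈ s, f i z) :=
  .of_memLp (continuous_finsetSum _ fun i _ => (hf i).cont)
    (fun j p => by simp only [fun i => (hf i).per j p])
    (memLp_finsetSum s fun i _ => (hf i).memLp)

lemma ip_sub_left {f g h : Pt d n → ℂ} (hf : Good f) (hg : Good g) (hh : Good h) :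
    ip (fun z => f z - g z) h = ip f h - ip g h := by
  unfold ip
  rw [← integral_sub (hf.int hh) (hg.int hh)]
  congr 1; funext z; exact inner_sub_left _ _ _

lemma ip_sub_right {f g h : Pt d n → ℂ} (hf : Good f) (hg : Good g) (hh : Good h) :
    ip h (fun z => f z - g z) = ip h f - ip h g := by
  rw [ip_comm, ip_sub_left hf hg hh, ip_comm f, ip_comm g]

lemma ip_smul_smul (c : ℝ) (f g : Pt d n → ℂ) :
    ip (fun z => c • f z) (fun z => c • g z) = c^2 * ip f g := by
  unfold ip
  rw [← integral_const_mul]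
  congr 1; funext z
  rw [real_inner_smul_left, real_inner_smul_right]; ring

lemma ip_sum {ι : Type*} (s : Finset ι) {f : ι → Pt d n → ℂ} (hf : ∀ i, Good (f i)) :
    ip (fun z => ∑ i ∈ s, f i z) (fun z => ∑ i ∈ s, f i z) = ∑ i ∈ s, ∑ j ∈ s, ip (f i) (f j) := by
  unfold ip
  simp_rw [sum_inner, inner_sum]
  rw [integral_finsetSum _ fun i _ => integrable_finsetSum _ fun j _ => (hf i).int (hf j)]
  refine Finset.sum_congr rfl fun i _ => ?_
  rw [integral_finsetSum _ fun j _ => (hf i).int (hf j)]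

lemma ip_shift {f g : Pt d n → ℂ} (hf : Good f) (hg : Good g) (a : Pt d n) :
    ip (fun z => f (z + a)) (fun z => g (z + a)) = ip f g := by
  unfold ip
  have hc : Continuous (fun z => inner ℝ (f z) (g z)) := hf.cont.inner hg.cont
  rw [integral_eq_lintegral_pos_part_sub_lintegral_neg_part ((hf.shift a).int (hg.shift a)),
    integral_eq_lintegral_pos_part_sub_lintegral_neg_part (hf.int hg)]
  congr 2
  · exact BNLS.shift (F := fun z => ENNReal.ofReal (inner ℝ (f z) (g z)))
      (by exact ENNReal.measurable_ofReal.comp hc.measurable)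
      (fun j p => by simp only [hf.per j p, hg.per j p]) a
  · exact BNLS.shift (F := fun z => ENNReal.ofReal (-inner ℝ (f z) (g z)))
      (by exact ENNReal.measurable_ofReal.comp hc.neg.measurable)
      (fun j p => by simp only [hf.per j p, hg.per j p]) a

lemma ip_D {f g : Pt d n → ℂ} (hf : Good f) (hg : Good g) (a : Pt d n) :
    ip (D a f) g = ip f (D (-a) g) := by
  have h1 := ip_sub_left (hf.shift a) hf hg
  have h2 := ip_sub_right (hg.shift (-a)) hg hf
  have h3 := ip_shift hf (hg.shift (-a)) a
  simp only [add_neg_cancel_right] at h3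
  unfold D
  rw [h1, h2, h3]

lemma D_comm (a b : Pt d n) (u : Pt d n → ℂ) : D a (D b u) = D b (D a u) := by
  funext z; unfold D; simp only [add_right_comm]; ring

lemma ip_DD {u : Pt d n → ℂ} (hu : Good u) (a b : Pt d n) :
    ip (D a (D (-a) u)) (D b (D (-b) u)) = ip (D (-b) (D (-a) u)) (D (-b) (D (-a) u)) := by
  rw [ip_D (hu.D _) ((hu.D _).D _), D_comm (-a) b, ip_comm, ip_D ((hu.D _).D _) (hu.D _),
    D_comm (-a) (-b)]

lemma pd_smul (c : ℝ) (a : Pt d n) (u : Pt d n → ℂ) : pd (c • a) u = fun z => c • pd a u z := by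
  funext z; unfold pd; simp

lemma pd_fun_smul (c : ℝ) (a : Pt d n) {u : Pt d n → ℂ} (hu : ContDiff ℝ 1 u) :
    pd a (fun z => c • u z) = fun z => c • pd a u z := by
  funext z; unfold pd
  rw [fderiv_fun_const_smul (hu.differentiable (by norm_num) z)]; rfl

lemma Av_smul (c : ℝ) (a : Pt d n) (u : Pt d n → ℂ) :
    Av a (fun z => c • u z) = fun z => c • Av a u z := by
  funext z; unfold Av; rw [intervalIntegral.integral_smul]

lemma DD_smul {u : Pt d n → ℂ} (hu : ContDiff ℝ 2 u) (s t : ℝ) (a b : Pt d n) :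
    D (s • a) (D (t • b) u) =
      fun z => (s * t) • Av (s • a) (Av (t • b) (pd b (pd a u))) z := by
  rw [DD_eq hu, pd_smul s a, pd_fun_smul s _ (pd_contDiff hu a), pd_smul t b]
  simp only [smul_smul]
  rw [Av_smul, Av_smul]

lemma Av_tendsto {g : Pt d n → ℂ} (hg : Continuous g) (c c' : ℝ) (a b : Pt d n) (z : Pt d n) :
    Tendsto (fun k : ℕ => Av (((1:ℝ)/((k:ℝ)+1) * c) • a) (Av (((1:ℝ)/((k:ℝ)+1) * c') • b) g) z) atTop (𝓝 (g z)) := by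
  have hc : Continuous (fun s : ℝ => Av ((s * c) • a) (Av ((s * c') • b) g) z) := by
    unfold Av
    apply intervalIntegral.continuous_parametric_intervalIntegral_of_continuous'
    unfold Function.uncurry
    apply intervalIntegral.continuous_parametric_intervalIntegral_of_continuous'
    unfold Function.uncurry
    fun_prop
  have h := (hc.tendsto 0).comp tendsto_one_div_add_atTop_nhds_zero_nat
  have h0 : Av (((0:ℝ) * c) • a) (Av (((0:ℝ) * c') • b) g) z = g z := by
    unfold Av; simp
  rw [h0] at h
  exact h

lemma fatou {u : Pt d n → ℂ} (hu : ContDiff ℝ 2 u) (hg : Good u) (a b : Pt d n) :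
    L (fun z => pd a (pd a u) z - pd b (pd b u) z) + 2 * L (pd a (pd b u))
      ≤ L (pd a (pd a u)) + L (pd b (pd b u)) := by
  let s : ℕ → ℝ := fun k => 1/((k:ℝ)+1)
  have hs : ∀ k, 0 < s k := fun k => by simp only [s]; positivity
  have hca := pd_cont (pd_contDiff hu a) a
  have hcb := pd_cont (pd_contDiff hu b) b
  have hcab := pd_cont (pd_contDiff hu b) a
  let f : ℕ → Pt d n → ℂ := fun k => Av ((s k * 1) • a) (Av ((s k * (-1)) • a) (pd a (pd a u)))
  let g : ℕ → Pt d n → ℂ := fun k => Av ((s k * 1) • b) (Av ((s k * (-1)) • b) (pd b (pd b u)))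
  let h : ℕ → Pt d n → ℂ := fun k => Av ((s k * (-1)) • b) (Av ((s k * (-1)) • a) (pd a (pd b u)))
  have fc : ∀ k, Continuous (f k) := fun k => Av_cont (Av_cont hca _) _
  have gc : ∀ k, Continuous (g k) := fun k => Av_cont (Av_cont hcb _) _
  have hc : ∀ k, Continuous (h k) := fun k => Av_cont (Av_cont hcab _) _
  have ef : ∀ k, (fun z => (-(s k)^2) • f k z) = D (s k • a) (D (-(s k • a)) u) := fun k => by
    have := DD_smul hu (s k * 1) (s k * (-1)) a a
    have e1 : (s k * (-1)) • a = -(s k • a) := by simp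
    have e2 : (s k * 1) • a = s k • a := by simp
    simp only [f]
    rw [e1, e2] at this ⊢
    rw [this]; funext z; congr 1; ring
  have eg : ∀ k, (fun z => (-(s k)^2) • g k z) = D (s k • b) (D (-(s k • b)) u) := fun k => by
    have := DD_smul hu (s k * 1) (s k * (-1)) b b
    have e1 : (s k * (-1)) • b = -(s k • b) := by simp
    have e2 : (s k * 1) • b = s k • b := by simp
    simp only [g]
    rw [e1, e2] at this ⊢
    rw [this]; funext z; congr 1; ring
  have eh : ∀ k, (fun z => ((s k)^2) • h k z) = D (-(s k • b)) (D (-(s k • a)) u) := fun k => by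
    have := DD_smul hu (s k * (-1)) (s k * (-1)) b a
    have e1 : (s k * (-1)) • b = -(s k • b) := by simp
    have e2 : (s k * (-1)) • a = -(s k • a) := by simp
    simp only [h]
    rw [e1, e2] at this ⊢
    rw [this]; funext z; congr 1; ring
  have inv : ∀ (c : ℝ), c ≠ 0 → ∀ F : Pt d n → ℂ, Good (fun z => c • F z) → Good F := by
    intro c hc F hF
    have := hF.smul c⁻¹
    simp only [smul_smul, inv_mul_cancel₀ hc, one_smul] at this
    exact this
  have fG : ∀ k, Good (f k) := fun k => inv (-(s k)^2) (by have := hs k; simp [this.ne']) _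
    (by rw [ef]; exact (hg.D _).D _)
  have gG : ∀ k, Good (g k) := fun k => inv (-(s k)^2) (by have := hs k; simp [this.ne']) _
    (by rw [eg]; exact (hg.D _).D _)
  have hG : ∀ k, Good (h k) := fun k => inv ((s k)^2) (by have := hs k; simp [this.ne']) _
    (by rw [eh]; exact (hg.D _).D _)
  have key : ∀ k, ip (f k) (g k) = ip (h k) (h k) := by
    intro k
    have := ip_DD hg (s k • a) (s k • b)
    rw [← ef, ← eg, ← eh, ip_smul_smul, ip_smul_smul] at this
    have h0 : (s k ^ 2)^2 ≠ 0 := by have := hs k; positivity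
    rw [neg_sq] at this
    exact mul_left_cancel₀ h0 this
  have key2 : ∀ k, L (fun z => f k z - g k z) + 2 * L (h k) = L (f k) + L (g k) := by
    intro k
    rw [L_eq ((fG k).sub (gG k)), L_eq (hG k), L_eq (fG k), L_eq (gG k)]
    rw [show (2:ℝ≥0∞) = ENNReal.ofReal 2 by simp, ← ENNReal.ofReal_mul (by norm_num),
      ← ENNReal.ofReal_add (ip_self_nonneg _) (mul_nonneg (by norm_num) (ip_self_nonneg _)),
      ← ENNReal.ofReal_add (ip_self_nonneg _) (ip_self_nonneg _)]
    congr 1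
    rw [ip_sub_left (fG k) (gG k) ((fG k).sub (gG k)), ip_sub_right (fG k) (gG k) (fG k),
      ip_sub_right (fG k) (gG k) (gG k), ← key k, ip_comm (g k) (f k)]
    ring
  have bound : ∀ k, L (fun z => f k z - g k z) + 2 * L (h k)
      ≤ L (pd a (pd a u)) + L (pd b (pd b u)) := by
    intro k
    rw [key2]
    have hpa := (hg.per.pd a).pd a
    have hpb := (hg.per.pd b).pd b
    exact add_le_add ((L_Av (Av_cont hca _) (hpa.Av _) _).trans (L_Av hca hpa _))
      ((L_Av (Av_cont hcb _) (hpb.Av _) _).trans (L_Av hcb hpb _))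
  have comb : ∀ F G : Pt d n → ℂ, Continuous F → L F + 2 * L G
      = ∫⁻ z, (‖F z‖ₑ^2 + 2 * ‖G z‖ₑ^2) ∂(μP d n) := by
    intro F G hF
    unfold L
    rw [lintegral_add_left (by fun_prop), lintegral_const_mul' _ _ (by norm_num)]
  rw [comb (fun z => pd a (pd a u) z - pd b (pd b u) z) _ (hca.sub hcb)]
  have lim : ∀ z, Tendsto (fun k => ‖f k z - g k z‖ₑ^2 + 2 * ‖h k z‖ₑ^2) atTop
      (𝓝 (‖pd a (pd a u) z - pd b (pd b u) z‖ₑ^2 + 2 * ‖pd a (pd b u) z‖ₑ^2)) := by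
    intro z
    have l1 := Av_tendsto hca 1 (-1) a a z
    have l2 := Av_tendsto hcb 1 (-1) b b z
    have l3 := Av_tendsto hcab (-1) (-1) b a z
    refine Tendsto.add ?_ ?_
    · exact (((ENNReal.continuous_pow 2).comp continuous_enorm).tendsto _).comp (l1.sub l2)
    · refine ENNReal.Tendsto.const_mul ?_ (Or.inr (by norm_num))
      exact (((ENNReal.continuous_pow 2).comp continuous_enorm).tendsto _).comp l3
  calc _ = ∫⁻ z, liminf (fun k => ‖f k z - g k z‖ₑ^2 + 2 * ‖h k z‖ₑ^2) atTop ∂(μP d n) := by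
        congr 1; funext z; exact (lim z).liminf_eq.symm
    _ ≤ liminf (fun k => ∫⁻ z, (‖f k z - g k z‖ₑ^2 + 2 * ‖h k z‖ₑ^2) ∂(μP d n)) atTop := by
        refine lintegral_liminf_le fun k => ?_
        have := fc k; have := gc k; have := hc k
        fun_prop
    _ ≤ _ := by
        refine liminf_le_of_le (by isBoundedDefault) fun c hc' => ?_
        obtain ⟨k, hk⟩ := hc'.exists
        refine hk.trans ?_
        rw [← comb (fun z => f k z - g k z) _ ((fc k).sub (gc k))]
        exact bound k

end BNLS

namespace BNLS

open scoped ENNReal Topology Pointwise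

variable {d n : ℕ}

/-- coordinate vectors -/
def ev (d n : ℕ) : Fin d ⊕ Fin n → Pt d n :=
  Sum.elim (fun i => (Pi.single i 1, 0)) (fun j => (0, Pi.single j 1))

/-- coordinates -/
def cf (w : Pt d n) : Fin d ⊕ Fin n → ℝ := Sum.elim w.1 w.2

lemma ev_sum (w : Pt d n) : w = ∑ k, cf w k • ev d n k := by
  rw [Fintype.sum_sum_type]
  ext i
  · simp [cf, ev, Prod.fst_sum, Finset.sum_apply, Pi.single_apply]
  · simp [cf, ev, Prod.snd_sum, Finset.sum_apply, Pi.single_apply]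

lemma cf_le (w : Pt d n) (k) : |cf w k| ≤ ‖w‖ := by
  rcases k with i | j
  · exact (norm_le_pi_norm w.1 i).trans (norm_fst_le w)
  · exact (norm_le_pi_norm w.2 j).trans (norm_snd_le w)

lemma pd_sum (w : Pt d n) (u : Pt d n → ℂ) (z) : pd w u z = ∑ k, cf w k • pd (ev d n k) u z := by
  unfold pd
  conv_lhs => rw [ev_sum w]
  rw [map_sum]; simp only [map_smul]

lemma L_lt_top_of {f : Pt d n → ℂ} {g : Pt d n → ℝ} (hg : Integrable g (μP d n))
    (h : ∀ z, ‖f z‖^2 ≤ g z) : L f < ⊤ := by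
  refine lt_of_le_of_lt ?_ hg.2
  unfold L
  refine lintegral_mono fun z => ?_
  rw [← ofReal_norm, ← ENNReal.ofReal_pow (norm_nonneg _), ← ofReal_norm]
  exact ENNReal.ofReal_le_ofReal ((h z).trans (le_abs_self _))

lemma InH2.good {u : Pt d n → ℂ} (hu : InH2 d n u) : Good u :=
  ⟨hu.1.continuous, hu.2.1, L_lt_top_of hu.2.2.1 fun _ => le_rfl⟩

lemma InH2.good2 {u : Pt d n → ℂ} (hu : InH2 d n u) (k) :
    Good (pd (ev d n k) (pd (ev d n k) u)) := by
  refine ⟨pd_cont (pd_contDiff hu.1 _) _, (Per.pd (Per.pd hu.2.1 _) _), ?_⟩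
  refine L_lt_top_of hu.2.2.2.2 fun z => ?_
  unfold hessInt
  have p1 : 0 ≤ (∑ i, ∑ i', ‖dX d n i (dX d n i' u) z‖^2) := by positivity
  have p2 : 0 ≤ (∑ i, ∑ j, ‖dY d n j (dX d n i u) z‖^2) := by positivity
  have p3 : 0 ≤ (∑ j, ∑ i, ‖dX d n i (dY d n j u) z‖^2) := by positivity
  have p4 : 0 ≤ (∑ j, ∑ j', ‖dY d n j (dY d n j' u) z‖^2) := by positivity
  rcases k with i | j
  · have : ‖dX d n i (dX d n i u) z‖^2 ≤ ∑ i, ∑ i', ‖dX d n i (dX d n i' u) z‖^2 := by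
      refine le_trans ?_ (Finset.single_le_sum (fun i _ => by positivity) (Finset.mem_univ i))
      exact Finset.single_le_sum (f := fun i' => ‖dX d n i (dX d n i' u) z‖^2)
        (fun i _ => by positivity) (Finset.mem_univ i)
    change ‖dX d n i (dX d n i u) z‖^2 ≤ _
    linarith
  · have : ‖dY d n j (dY d n j u) z‖^2 ≤ ∑ i, ∑ i', ‖dY d n i (dY d n i' u) z‖^2 := by
      refine le_trans ?_ (Finset.single_le_sum (fun i _ => by positivity) (Finset.mem_univ j))
      exact Finset.single_le_sum (f := fun i' => ‖dY d n j (dY d n i' u) z‖^2)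
        (fun i _ => by positivity) (Finset.mem_univ j)
    change ‖dY d n j (dY d n j u) z‖^2 ≤ _
    linarith

lemma ip_nonneg {u : Pt d n → ℂ} (hu : InH2 d n u) (k l) :
    0 ≤ ip (pd (ev d n k) (pd (ev d n k) u)) (pd (ev d n l) (pd (ev d n l) u)) := by
  have hk := hu.good2 k
  have hl := hu.good2 l
  have h : L (fun z => pd (ev d n k) (pd (ev d n k) u) z - pd (ev d n l) (pd (ev d n l) u) z) ≤ 
     L (pd (ev d n k) (pd (ev d n k) u)) + L (pd (ev d n l) (pd (ev d n l) u)) :=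
    le_trans le_self_add (fatou hu.1 hu.good (ev d n k) (ev d n l))
  rw [L_eq (hk.sub hl), L_eq hk, L_eq hl, ← ENNReal.ofReal_add (ip_self_nonneg _) (ip_self_nonneg _),
    ENNReal.ofReal_le_ofReal_iff (add_nonneg (ip_self_nonneg _) (ip_self_nonneg _)),
    ip_sub_left hk hl (hk.sub hl), ip_sub_right hk hl hk, ip_sub_right hk hl hl,
    ip_comm (pd (ev d n l) (pd (ev d n l) u))] at h
  linarith

lemma sum_le_of_nonneg {ι : Type*} [Fintype ι] (F : ι → ι → ℝ) (h : ∀ i j, 0 ≤ F i j) :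
    ∑ i, F i i ≤ ∑ i, ∑ j, F i j :=
  Finset.sum_le_sum fun i _ => Finset.single_le_sum (f := F i) (fun j _ => h i j) (Finset.mem_univ i)

lemma ip_self_eq (f : Pt d n → ℂ) : ip f f = ∫ z, ‖f z‖^2 ∂(μP d n) := by
  unfold ip; simp only [real_inner_self_eq_norm_sq]

lemma lapX_ge {u : Pt d n → ℂ} (hu : InH2 d n u) :
    ∑ i : Fin d, ip (pd (ev d n (.inl i)) (pd (ev d n (.inl i)) u)) 
      (pd (ev d n (.inl i)) (pd (ev d n (.inl i)) u)) ≤ lapXSq d n u := by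
  have : lapXSq d n u = ip (lapX d n u) (lapX d n u) := (ip_self_eq _).symm
  rw [this]
  have h2 := ip_sum Finset.univ (f := fun i : Fin d => pd (ev d n (.inl i)) (pd (ev d n (.inl i)) u))
    (fun i => hu.good2 (.inl i))
  refine le_trans (sum_le_of_nonneg _ fun i j => ip_nonneg hu (.inl i) (.inl j)) h2.ge

lemma lapY_ge {u : Pt d n → ℂ} (hu : InH2 d n u) :
    ∑ i : Fin n, ip (pd (ev d n (.inr i)) (pd (ev d n (.inr i)) u)) 
      (pd (ev d n (.inr i)) (pd (ev d n (.inr i)) u)) ≤ lapYSq d n u := by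
  have : lapYSq d n u = ip (lapY d n u) (lapY d n u) := (ip_self_eq _).symm
  rw [this]
  have h2 := ip_sum Finset.univ (f := fun i : Fin n => pd (ev d n (.inr i)) (pd (ev d n (.inr i)) u))
    (fun i => hu.good2 (.inr i))
  refine le_trans (sum_le_of_nonneg _ fun i j => ip_nonneg hu (.inr i) (.inr j)) h2.ge

lemma sumL_le {u : Pt d n → ℂ} (hu : InH2 d n u) :
    ∑ k, L (pd (ev d n k) (pd (ev d n k) u)) ≤ ENNReal.ofReal (lapXSq d n u + lapYSq d n u) := by
  simp_rw [fun k => L_eq (hu.good2 k)]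
  rw [← ENNReal.ofReal_sum_of_nonneg fun k _ => ip_self_nonneg _]
  apply ENNReal.ofReal_le_ofReal
  rw [Fintype.sum_sum_type]
  exact add_le_add (lapX_ge hu) (lapY_ge hu)

lemma L_mixed {u : Pt d n → ℂ} (hu : InH2 d n u) (k l) :
    L (pd (ev d n k) (pd (ev d n l) u)) ≤ ENNReal.ofReal (lapXSq d n u + lapYSq d n u) := by
  have h : 2 * L (pd (ev d n k) (pd (ev d n l) u)) ≤ 
     L (pd (ev d n k) (pd (ev d n k) u)) + L (pd (ev d n l) (pd (ev d n l) u)) :=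
    le_trans le_add_self (fatou hu.1 hu.good (ev d n k) (ev d n l))
  have hs : ∀ k, L (pd (ev d n k) (pd (ev d n k) u)) ≤ ENNReal.ofReal (lapXSq d n u + lapYSq d n u) :=
    fun k => le_trans (Finset.single_le_sum (f := fun k => L (pd (ev d n k) (pd (ev d n k) u)))
      (fun _ _ => zero_le) (Finset.mem_univ k)) (sumL_le hu)
  have h2 := h.trans (add_le_add (hs k) (hs l))
  rw [← two_mul] at h2
  exact (ENNReal.mul_le_mul_iff_right (by norm_num) (by norm_num)).1 h2

lemma L_dir {u : Pt d n → ℂ} (hu : InH2 d n u) (w : Pt d n) (h : ℝ) (hw : ‖w‖ ≤ h) :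
    L (pd w (pd w u)) ≤ ENNReal.ofReal (((d:ℝ)+n)^4 * h^4 * (lapXSq d n u + lapYSq d n u)) := by
  have hh : 0 ≤ h := (norm_nonneg _).trans hw
  let I := (Fin d ⊕ Fin n) × (Fin d ⊕ Fin n)
  let x : I → Pt d n → ℂ := fun q => pd (ev d n q.1) (pd (ev d n q.2) u)
  have hcard : (Fintype.card I : ℝ) = ((d:ℝ)+n)^2 := by simp [I]; ring
  have e : ∀ z, pd w (pd w u) z = ∑ q : I, (cf w q.1 * cf w q.2) • x q z := by
    intro z
    rw [Fintype.sum_prod_type, pd_sum w (pd w u)]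
    refine Finset.sum_congr rfl fun k _ => ?_
    have : pd w u = fun z => ∑ l, cf w l • pd (ev d n l) u z := by funext z; exact pd_sum w u z
    have h3 : pd (ev d n k) (pd w u) z = ∑ l, cf w l • pd (ev d n k) (pd (ev d n l) u) z := by
      rw [this]
      unfold pd
      have hd : ∀ l, DifferentiableAt ℝ (fun z => (fderiv ℝ u z) (ev d n l)) z := fun l =>
        (pd_contDiff hu.1 (ev d n l)).differentiable (by norm_num) z
      have hd2 : ∀ l, DifferentiableAt ℝ (fun z => cf w l • (fderiv ℝ u z) (ev d n l)) z :=
        fun l => (hd l).fun_const_smul (cf w l)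
      rw [fderiv_fun_sum (fun l _ => hd2 l)]
      rw [ContinuousLinearMap.sum_apply]
      refine Finset.sum_congr rfl fun l _ => ?_
      rw [fderiv_fun_const_smul (hd l)]; rfl
    rw [h3, Finset.smul_sum]
    refine Finset.sum_congr rfl fun l _ => ?_
    rw [smul_smul]
  have pt : ∀ z, ‖pd w (pd w u) z‖^2 ≤ ∑ q : I, ((d:ℝ)+n)^2 * h^4 * ‖x q z‖^2 := by
    intro z
    rw [e z]
    calc ‖∑ q : I, (cf w q.1 * cf w q.2) • x q z‖^2 
        ≤ (∑ q : I, h^2 * ‖x q z‖)^2 := by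
          gcongr
          refine (norm_sum_le _ _).trans (Finset.sum_le_sum fun q _ => ?_)
          rw [norm_smul, Real.norm_eq_abs, abs_mul, sq]
          gcongr
          · exact (cf_le w _).trans hw
          · exact (cf_le w _).trans hw
      _ ≤ (Fintype.card I : ℝ) * ∑ q : I, (h^2 * ‖x q z‖)^2 := sq_sum_le_card_mul_sum_sq
      _ = _ := by
          rw [hcard, Finset.mul_sum]
          refine Finset.sum_congr rfl fun q _ => ?_
          ring
  have hx : ∀ q, Continuous (x q) := fun q => pd_cont (pd_contDiff hu.1 _) _
  calc L (pd w (pd w u)) ≤ ∫⁻ z, ∑ q : I, ENNReal.ofReal (((d:ℝ)+n)^2 * h^4) * ‖x q z‖ₑ^2 ∂(μP d n) := by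
        unfold L
        refine lintegral_mono fun z => ?_
        have := ENNReal.ofReal_le_ofReal (pt z)
        rw [ENNReal.ofReal_sum_of_nonneg fun q _ => by positivity, ENNReal.ofReal_pow (norm_nonneg _),
          ofReal_norm] at this
        refine this.trans (Finset.sum_le_sum fun q _ => ?_)
        rw [ENNReal.ofReal_mul (by positivity), ENNReal.ofReal_pow (norm_nonneg _), ofReal_norm]
    _ = ∑ q : I, ENNReal.ofReal (((d:ℝ)+n)^2 * h^4) * L (x q) := by
        rw [lintegral_finsetSum _ fun q _ => by have := hx q; fun_prop]
        refine Finset.sum_congr rfl fun q _ => ?_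
        rw [lintegral_const_mul' _ _ (by finiteness)]; rfl
    _ ≤ ∑ q : I, ENNReal.ofReal (((d:ℝ)+n)^2 * h^4) * ENNReal.ofReal (lapXSq d n u + lapYSq d n u) := by
        gcongr with q; exact L_mixed hu _ _
    _ = _ := by
        rw [Finset.sum_const, nsmul_eq_mul, Finset.card_univ, ← ENNReal.ofReal_mul (by positivity),
          ← ENNReal.ofReal_natCast, hcard, ← ENNReal.ofReal_mul (by positivity)]
        congr 1; ring

end BNLS

namespace BNLS

open scoped ENNReal Topology Pointwise

variable {d n : ℕ}

instance instHaarPt : (volume : Measure (Pt d n)).IsAddHaarMeasure :=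
  Measure.prod.instIsAddHaarMeasure volume volume

/-- uniform measure on the sup-norm ball -/
def nu (d n : ℕ) (h : ℝ) : Measure (Pt d n) :=
  (volume (Metric.closedBall (0 : Pt d n) h))⁻¹ • volume.restrict (Metric.closedBall (0 : Pt d n) h)

lemma nu_prob (h : ℝ) (hh : 0 < h) : IsProbabilityMeasure (nu d n h) := by
  refine ⟨?_⟩
  unfold nu
  simp only [Measure.smul_apply, smul_eq_mul, Measure.restrict_apply_univ]
  refine ENNReal.inv_mul_cancel ?_ ?_
  · exact (Metric.measure_closedBall_pos volume _ hh).ne'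
  · exact measure_closedBall_lt_top.ne

lemma nu_neg (h : ℝ) (F : Pt d n → ℂ) :
    ∫ w, F (-w) ∂(nu d n h) = ∫ w, F w ∂(nu d n h) := by
  unfold nu
  rw [integral_smul_measure, integral_smul_measure]
  congr 1
  have hmp : MeasurePreserving (fun w : Pt d n => -w) volume volume :=
    (Measure.measurePreserving_neg (volume : Measure (Fin d → ℝ))).prod
      (Measure.measurePreserving_neg (volume : Measure (Fin n → ℝ)))
  have := hmp.setIntegral_preimage_emb
    (MeasurableEquiv.neg (Pt d n)).measurableEmbedding F (Metric.closedBall 0 h)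
  rw [← this]
  congr 2
  ext x; simp

lemma nu_ae (h : ℝ) : ∀ᵐ w ∂(nu d n h), ‖w‖ ≤ h := by
  unfold nu
  refine Measure.ae_smul_measure ?_ _
  refine (ae_restrict_iff' Metric.isClosed_closedBall.measurableSet).2 (.of_forall fun w hw => ?_)
  simpa using hw

lemma nu_int (h : ℝ) (hh : 0 < h) {F : Pt d n → ℂ} (hF : Continuous F) :
    Integrable F (nu d n h) := by
  unfold nu
  refine Integrable.smul_measure ?_ ?_
  · exact hF.continuousOn.integrableOn_compact (isCompact_closedBall _ _)
  · exact ENNReal.inv_ne_top.2 (Metric.measure_closedBall_pos volume _ hh).ne'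

/-- averaging over the ball -/
def Sm (h : ℝ) (u : Pt d n → ℂ) (z : Pt d n) : ℂ := ∫ w, u (z + w) ∂(nu d n h)

lemma Sm_sup (h : ℝ) (hh : 0 < h) (h1 : h ≤ 1) {u : Pt d n → ℂ} (hu : Good u) (z : Pt d n) :
    ‖Sm h u z‖ₑ ^ 2 ≤ (volume (Metric.closedBall (0 : Pt d n) h))⁻¹ * L u := by
  have := nu_prob (d := d) (n := n) h hh
  have hc := hu.cont
  refine (jensen_sq (nu d n h) (fun w => u (z + w)) (by
    exact Continuous.aestronglyMeasurable (by fun_prop))).trans ?_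
  unfold nu
  rw [lintegral_smul_measure, smul_eq_mul]
  gcongr
  let c : Pt d n := (0, fun _ => -h)
  rw [← L_shift hu.cont hu.per (z + c)]
  unfold L
  have e := (measurePreserving_add_right (volume : Measure (Pt d n)) c).setLIntegral_comp_preimage_emb
    (measurableEmbedding_addRight c) (fun w => ‖u (z + w)‖ₑ^2) (Metric.closedBall 0 h)
  rw [← e]
  have e2 : μP d n = volume.restrict (Set.univ ×ˢ torusBox n) := by
    unfold μP μT
    rw [Measure.volume_eq_prod, ← Measure.prod_restrict, Measure.restrict_univ]
  rw [e2]
  have hpi : 2 * h < 2 * π := by have := Real.pi_gt_three; linarith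
  refine le_trans (lintegral_mono_set (t := Set.univ ×ˢ torusBox n) ?_) (le_of_eq ?_)
  · intro w hw
    simp only [Set.mem_preimage, Metric.mem_closedBall, dist_zero_right] at hw
    refine ⟨trivial, fun j _ => ?_⟩
    have := (norm_le_pi_norm (w + c).2 j).trans ((norm_snd_le (w + c)).trans hw)
    simp only [Prod.snd_add, Pi.add_apply, c, Real.norm_eq_abs, abs_le] at this
    constructor <;> linarith
  · congr 1; funext w; congr 3; abel

lemma Sm_diff (h : ℝ) (hh : 0 < h) {u : Pt d n → ℂ} (hu : InH2 d n u) :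
    L (fun z => 2 * (u z - Sm h u z)) ≤
      ENNReal.ofReal (((d:ℝ)+n)^4 * h^4 * (lapXSq d n u + lapYSq d n u)) := by
  have := nu_prob (d := d) (n := n) h hh
  have hc := hu.1.continuous
  have e : (fun z => 2 * (u z - Sm h u z)) = fun z => ∫ w, D w (D (-w) u) z ∂(nu d n h) := by
    funext z
    unfold D Sm
    simp only [add_neg_cancel_right]
    rw [integral_sub, integral_sub, integral_sub, nu_neg h (fun w => u (z + w))]
    · simp; ring
    all_goals exact nu_int h hh (by fun_prop)
  rw [e]
  apply jensen
  · apply Continuous.stronglyMeasurable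
    unfold Function.uncurry D
    fun_prop
  · filter_upwards [nu_ae h] with w hw
    refine (L_DD hu.1 hu.2.1 w (-w)).trans (le_trans (le_of_eq ?_) (L_dir hu w h hw))
    unfold L pd
    simp

lemma L_one {u : Pt d n → ℂ} (hu : u ∈ Sset d n 1) : L u = 1 := by
  rw [L_eq hu.1.good, ip_self_eq]
  have := hu.2
  unfold Mass at this
  rw [this]; simp

lemma cheb {f : Pt d n → ℂ} (hf : Continuous f) (t : ℝ) (ht : 0 < t) (s : Set (Pt d n))
    (hs : ∀ z ∈ s, t ≤ ‖f z‖) :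
    μP d n s ≤ L f * ENNReal.ofReal (t ^ (-2:ℝ)) := by
  have h1 := meas_ge_le_lintegral_div (μ := μP d n) (f := fun z => ‖f z‖ₑ^2) (by fun_prop)
    (ε := ENNReal.ofReal (t^2)) (by simpa using by positivity) (by finiteness)
  have h2 : s ⊆ {z | ENNReal.ofReal (t^2) ≤ ‖f z‖ₑ^2} := by
    intro z hz
    simp only [Set.mem_ofPred_eq]
    rw [← ofReal_norm, ← ENNReal.ofReal_pow (norm_nonneg _)]
    apply ENNReal.ofReal_le_ofReal
    have := hs z hz
    gcongr
  refine (measure_mono h2).trans (h1.trans (le_of_eq ?_))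
  rw [div_eq_mul_inv, ← ENNReal.ofReal_inv_of_pos (by positivity)]
  unfold L
  congr 2
  rw [Real.rpow_neg ht.le]; norm_cast

lemma weak (hd : 1 ≤ d) : ∃ C T0 : ℝ, 0 < C ∧ 0 < T0 ∧ ∀ u ∈ Sset d n 1, ∀ t, T0 ≤ t →
    μP d n {z | t < ‖u z‖} ≤
      ENNReal.ofReal (C * (lapXSq d n u + lapYSq d n u) * t ^ (-2 - 8/((d:ℝ)+n))) := by
  let V : ℝ := (volume (Metric.ball (0 : Pt d n) 1)).toReal
  have hVtop : volume (Metric.ball (0 : Pt d n) 1) ≠ ⊤ := measure_ball_lt_top.ne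
  have hV : 0 < V := ENNReal.toReal_pos (Metric.measure_ball_pos volume _ one_pos).ne' hVtop
  have hN : (0:ℝ) < (d:ℝ) + n := by positivity
  refine ⟨((d:ℝ)+n)^4 * (4/V)^(4/((d:ℝ)+n)), (4/V)^((1:ℝ)/2), by positivity, by positivity, ?_⟩
  intro u hu t ht
  have ht0 : 0 < t := lt_of_lt_of_le (by positivity) ht
  let h : ℝ := (4/V * t^(-2:ℝ))^(1/((d:ℝ)+n))
  have hh : 0 < h := by positivity
  have hhN : h ^ (d+n) = 4/V * t^(-2:ℝ) := by
    simp only [h]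
    rw [← Real.rpow_natCast, ← Real.rpow_mul (by positivity)]
    push_cast
    rw [one_div, inv_mul_cancel₀ hN.ne', Real.rpow_one]
  have hh1 : h ≤ 1 := by
    apply Real.rpow_le_one (by positivity) _ (by positivity)
    rw [Real.rpow_neg ht0.le, ← div_eq_mul_inv, div_le_one (by positivity)]
    calc 4/V = ((4/V)^((1:ℝ)/2))^(2:ℝ) := by
          rw [← Real.rpow_mul (by positivity)]; norm_num
      _ ≤ t^(2:ℝ) := by gcongr
  have hh4 : h^4 = (4/V)^(4/((d:ℝ)+n)) * t^(-8/((d:ℝ)+n)) := by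
    simp only [h]
    rw [← Real.rpow_natCast, ← Real.rpow_mul (by positivity),
      Real.mul_rpow (by positivity) (by positivity), ← Real.rpow_mul ht0.le]
    push_cast
    congr 2 <;> ring
  have hsup : ∀ z, ‖Sm h u z‖ ≤ t/2 := by
    intro z
    have h1 := Sm_sup h hh hh1 hu.1.good z
    rw [L_one hu, mul_one, Measure.addHaar_closedBall _ _ hh.le] at h1
    have hf : Module.finrank ℝ (Pt d n) = d + n := by simp
    rw [hf, hhN, ← ENNReal.ofReal_toReal hVtop, ← ENNReal.ofReal_mul (by positivity),
      ← ENNReal.ofReal_inv_of_pos (by positivity), ← ofReal_norm,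
      ← ENNReal.ofReal_pow (norm_nonneg _), ENNReal.ofReal_le_ofReal_iff (by positivity)] at h1
    have h2 : (4 / V * t ^ (-2:ℝ) * (volume (Metric.ball (0 : Pt d n) 1)).toReal)⁻¹ = (t/2)^2 := by
      change (4 / V * t ^ (-2:ℝ) * V)⁻¹ = (t/2)^2
      rw [Real.rpow_neg ht0.le, Real.rpow_two]
      field_simp
      norm_num
    rw [h2] at h1
    exact (pow_le_pow_iff_left₀ (norm_nonneg _) (by positivity) (by norm_num)).1 h1
  have hSc : Continuous (Sm h u) := by
    have := nu_prob (d := d) (n := n) h hh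
    have e : Sm h u = fun z => (volume (Metric.closedBall (0 : Pt d n) h))⁻¹.toReal •
        ∫ w in Metric.closedBall (0 : Pt d n) h, u (z + w) := by
      funext z; unfold Sm nu; rw [integral_smul_measure]
    rw [e]
    refine Continuous.fun_const_smul ?_ _
    have hc := hu.1.1.continuous
    exact continuous_parametric_integral_of_continuous (by unfold Function.uncurry; fun_prop)
      (isCompact_closedBall _ _)
  have hc := hu.1.1.continuous
  refine (cheb (f := fun z => 2 * (u z - Sm h u z)) (by fun_prop) t ht0 _ ?_).trans ?_
  · intro z hz
    simp only [Set.mem_ofPred_eq] at hz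
    rw [norm_mul]
    have := norm_sub_norm_le (u z) (Sm h u z)
    have := hsup z
    simp only [Complex.norm_ofNat]
    linarith
  · refine (mul_le_mul_left (Sm_diff h hh hu.1) _).trans (le_of_eq ?_)
    rw [← ENNReal.ofReal_mul' (by positivity)]
    congr 1
    rw [hh4, sub_eq_add_neg, Real.rpow_add ht0, neg_div]
    ring

lemma GN (hd : 1 ≤ d) (α : ℝ) (hα : 0 < α) (hα' : α < 8 / ((d:ℝ)+n)) :
    ∃ C0 : ℝ, ∀ u ∈ Sset d n 1,
      Npow d n (α+2) u ≤ C0 + (α+2)/2 * (lapXSq d n u + lapYSq d n u) := by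
  obtain ⟨C, T0, hC, hT0, hw⟩ := weak (d := d) (n := n) hd
  let δ : ℝ := 8 / ((d:ℝ)+n) - α
  have hδ : 0 < δ := by simp only [δ]; linarith
  obtain ⟨T, hT, hTs⟩ : ∃ T, T0 ≤ T ∧ C * T^(-δ) / δ ≤ 1/2 := by
    have h1 : Tendsto (fun T : ℝ => C * T^(-δ) / δ) atTop (𝓝 (C * 0 / δ)) :=
      ((tendsto_rpow_neg_atTop hδ).const_mul C).div_const δ
    rw [mul_zero, zero_div] at h1
    have h2 := h1.eventually (ge_mem_nhds (show (0:ℝ) < 1/2 by norm_num))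
    obtain ⟨T, h3, h4⟩ := (h2.and (eventually_ge_atTop T0)).exists
    exact ⟨T, h4, h3⟩
  have hTpos : 0 < T := hT0.trans_le hT
  refine ⟨(α+2) * (T^α/α), fun u hu => ?_⟩
  let K := lapXSq d n u + lapYSq d n u
  have hK : 0 ≤ K := add_nonneg (integral_nonneg fun z => by positivity)
    (integral_nonneg fun z => by positivity)
  have hc := hu.1.1.continuous
  have main : ∫⁻ z, ENNReal.ofReal (‖u z‖ ^ (α+2)) ∂(μP d n) ≤
      ENNReal.ofReal ((α+2) * (T^α/α + K * (C * T^(-δ) / δ))) := by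
    rw [lintegral_rpow_eq_lintegral_meas_lt_mul (μP d n) (.of_forall fun z => norm_nonneg _)
      (by fun_prop) (by linarith), ENNReal.ofReal_mul (by linarith)]
    gcongr
    rw [← Set.Ioc_union_Ioi_eq_Ioi hTpos.le, lintegral_union measurableSet_Ioi
      (by rw [Set.disjoint_left]; intro x hx hx'; exact absurd hx.2 (not_le.2 hx')),
      ENNReal.ofReal_add (by positivity) (by positivity)]
    refine add_le_add ?_ ?_
    · have hi : IntervalIntegrable (fun t : ℝ => t^(α-1)) volume 0 T :=
        intervalIntegral.intervalIntegrable_rpow' (by linarith)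
      have hv : ∫ t in Set.Ioc 0 T, t^(α-1) = T^α/α := by
        rw [← intervalIntegral.integral_of_le hTpos.le, integral_rpow (Or.inl (by linarith))]
        simp [Real.zero_rpow hα.ne']
      rw [← hv, ofReal_integral_eq_lintegral_ofReal
        ((intervalIntegrable_iff_integrableOn_Ioc_of_le hTpos.le).1 hi)]
      · refine setLIntegral_mono' measurableSet_Ioc fun t ht => ?_
        have h1 := cheb hc t ht.1 {z | t < ‖u z‖} (fun z hz => le_of_lt hz)
        rw [L_one hu, one_mul] at h1
        refine (mul_le_mul_left h1 _).trans (le_of_eq ?_)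
        rw [← ENNReal.ofReal_mul (Real.rpow_nonneg ht.1.le _), ← Real.rpow_add ht.1]
        congr 2; ring
      · refine (ae_restrict_iff' measurableSet_Ioc).2 (.of_forall fun t ht => ?_)
        exact Real.rpow_nonneg ht.1.le _
    · have hlt : -δ - 1 < -1 := by linarith
      have hi := integrableOn_Ioi_rpow_of_lt hlt hTpos
      have hv := integral_Ioi_rpow_of_lt hlt hTpos
      have hv2 : ∫ t in Set.Ioi T, (C * K) * t^(-δ-1) = K * (C * T^(-δ) / δ) := by
        rw [integral_const_mul, hv]
        simp only [sub_add_cancel]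
        rw [neg_div_neg_eq]; ring
      rw [← hv2, ofReal_integral_eq_lintegral_ofReal (Integrable.const_mul hi _)]
      · refine setLIntegral_mono' measurableSet_Ioi fun t ht => ?_
        have ht0 : 0 < t := hTpos.trans ht
        have h1 := hw u hu t (hT.trans (le_of_lt ht))
        refine (mul_le_mul_left h1 _).trans (le_of_eq ?_)
        rw [← ENNReal.ofReal_mul' (by positivity), mul_assoc, ← Real.rpow_add ht0]
        congr 3; simp only [δ]; ring
      · refine (ae_restrict_iff' measurableSet_Ioi).2 (.of_forall fun t ht => ?_)
        have ht0 : 0 < t := hTpos.trans ht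
        simp only [Pi.zero_apply]
        positivity
  unfold Npow
  rw [integral_eq_lintegral_of_nonneg_ae (.of_forall fun z => by positivity)
    (by apply Measurable.aestronglyMeasurable; fun_prop)]
  refine (ENNReal.toReal_le_of_le_ofReal (by positivity) main).trans ?_
  have : K * (C * T^(-δ) / δ) ≤ K * (1/2) := by gcongr
  have h3 : (α+2) * (K * (C * T^(-δ) / δ)) ≤ (α+2) * (K * (1/2)) := by gcongr
  change _ ≤ (α+2) * (T^α/α) + (α+2)/2 * K
  linarith

end BNLS


namespace BNLS

open scoped ENNReal Topology Pointwise ContDiff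

variable {d n : ℕ}

/-- smooth functions independent of `y`, with compact support in `x` -/
structure Nice (R : ℝ) (f : Pt d n → ℂ) : Prop where
  smooth : ContDiff ℝ ∞ f
  van : ∀ z, R < ‖z.1‖ → f z = 0
  indep : ∀ (z : Pt d n) (w : Fin n → ℝ), f (z + (0, w)) = f z

lemma Nice.dX {R : ℝ} {f : Pt d n → ℂ} (hf : Nice R f) (i : Fin d) :
    Nice R (dX d n i f) := by
  refine ⟨?_, ?_, ?_⟩
  · unfold BNLS.dX
    exact (hf.smooth.fderiv_right (m := ∞) (by simp)).clm_apply contDiff_const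
  · intro z hz
    have : f =ᶠ[𝓝 z] fun _ => 0 := by
      have ho : IsOpen {z : Pt d n | R < ‖z.1‖} := isOpen_lt (by fun_prop) (by fun_prop)
      filter_upwards [ho.mem_nhds hz] with w hw using hf.van w hw
    unfold BNLS.dX
    rw [this.fderiv_eq]; simp
  · intro z w
    unfold BNLS.dX
    rw [← fderiv_comp_add_right]
    simp only [hf.indep]

lemma Nice.dY {R : ℝ} {f : Pt d n → ℂ} (hf : Nice R f) (j : Fin n) :
    dY d n j f = fun _ => 0 := by
  funext z
  unfold BNLS.dY
  have hd : DifferentiableAt ℝ f z := (hf.smooth.differentiable (by simp)) z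
  rw [← hd.lineDeriv_eq_fderiv]
  unfold lineDeriv
  have : (fun t : ℝ => f (z + t • ((0 : Fin d → ℝ), (Pi.single j 1 : Fin n → ℝ))))
      = fun _ => f z := by
    funext t
    rw [Prod.smul_mk, smul_zero, hf.indep]
  rw [this]; simp

lemma dY_zero (j : Fin n) : dY d n j (fun _ => 0) = fun _ => 0 := by
  funext z; simp [BNLS.dY]

lemma dX_zero (j : Fin d) : dX d n j (fun _ => 0) = fun _ => 0 := by
  funext z; simp [BNLS.dX]

lemma Nice.integrable {R : ℝ} {f : Pt d n → ℂ} (hf : Nice R f) :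
    Integrable (fun z => ‖f z‖^2) (μP d n) := by
  have hμ : μP d n = (volume : Measure (Pt d n)).restrict (univ ×ˢ torusBox n) := by
    unfold μP μT
    rw [Measure.volume_eq_prod, ← Measure.prod_restrict, Measure.restrict_univ]
  rw [hμ]
  have hc : Continuous f := hf.smooth.continuous
  have h1 : IntegrableOn (fun z => ‖f z‖^2)
      (Metric.closedBall (0 : Fin d → ℝ) R ×ˢ Set.univ.pi fun _ : Fin n => Set.Icc 0 (2*π))
      (volume : Measure (Pt d n)) :=
    Continuous.continuousOn (by fun_prop) |>.integrableOn_compact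
      ((isCompact_closedBall _ _).prod (isCompact_univ_pi fun _ => isCompact_Icc))
  refine IntegrableOn.of_forall_sdiff_eq_zero h1 ?_ ?_
  · exact MeasurableSet.univ.prod (MeasurableSet.univ_pi fun _ => measurableSet_Ico)
  · rintro z ⟨⟨-, hz⟩, hz'⟩
    have : R < ‖z.1‖ := by
      by_contra hcon
      refine hz' ⟨by simpa using hcon, fun i hi => ?_⟩
      exact Set.Ico_subset_Icc_self (hz i hi)
    simp [hf.van z this]

lemma Nice.inH2 {R : ℝ} {f : Pt d n → ℂ} (hf : Nice R f) : InH2 d n f := by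
  refine ⟨contDiff_infty.1 hf.smooth 2, ?_, hf.integrable, ?_, ?_⟩
  · intro j p
    have := hf.indep p ((2*π) • (Pi.single j 1 : Fin n → ℝ))
    rw [← this]
    congr 1
    ext <;> simp
  · simp only [hf.dY]
    refine Integrable.add ?_ ?_
    · exact integrable_finsetSum _ fun i _ => (hf.dX i).integrable
    · simp
  · have : hessInt d n f = fun z => ∑ i, ∑ i', ‖BNLS.dX d n i (BNLS.dX d n i' f) z‖^2 := by
      funext z
      unfold hessInt
      simp [hf.dY, (hf.dX _).dY, dY_zero, dX_zero]
    rw [this]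
    exact integrable_finsetSum _ fun i _ => integrable_finsetSum _ fun i' _ =>
      ((hf.dX i').dX i).integrable

lemma Nice.lapYSq {R : ℝ} {f : Pt d n → ℂ} (hf : Nice R f) : lapYSq d n f = 0 := by
  unfold BNLS.lapYSq lapY
  simp [hf.dY, dY_zero]

lemma exists_test (d n : ℕ) : ∃ v ∈ Sset d n 1, lapYSq d n v = 0 := by
  let φ : ContDiffBump (0 : Fin d → ℝ) := ⟨1, 2, by norm_num, by norm_num⟩
  let f : Pt d n → ℂ := fun z => (φ z.1 : ℂ)
  have hfs : ContDiff ℝ ∞ f := by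
    have h2 : ContDiff ℝ ∞ (fun z : Pt d n => φ z.1) := φ.contDiff.comp contDiff_fst
    exact Complex.ofRealCLM.contDiff.comp h2
  have hf : Nice 2 f := by
    refine ⟨hfs, ?_, ?_⟩
    · intro z hz
      have : φ z.1 = 0 := φ.zero_of_le_dist (by simpa using hz.le)
      simp [f, this]
    · intro z w
      simp [f]
  have hpos : 0 < Mass d n f := by
    unfold Mass
    rw [integral_pos_iff_support_of_nonneg (fun z => by positivity) hf.integrable]
    have hsub : Metric.closedBall (0 : Fin d → ℝ) 1 ×ˢ torusBox n ⊆
        Function.support (fun z : Pt d n => ‖f z‖^2) := by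
      rintro z ⟨hz, -⟩
      have : φ z.1 = 1 := φ.one_of_mem_closedBall hz
      simp [f, this]
    refine lt_of_lt_of_le ?_ (measure_mono hsub)
    unfold μP
    rw [Measure.prod_prod]
    refine ENNReal.mul_pos (Metric.measure_closedBall_pos volume _ one_pos).ne' ?_
    unfold μT
    rw [Measure.restrict_apply_self]
    unfold torusBox
    rw [volume_pi_pi]
    simp [Finset.prod_ne_zero_iff, pi_pos]
  let c : ℝ := (√(Mass d n f))⁻¹
  have hg : Nice 2 (fun z => (c : ℂ) * f z) := by
    refine ⟨contDiff_const.mul hf.smooth, fun z hz => ?_, fun z w => ?_⟩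
    · simp [hf.van z hz]
    · simp [hf.indep]
  refine ⟨_, ⟨hg.inH2, ?_⟩, hg.lapYSq⟩
  unfold Mass
  simp only [norm_mul, mul_pow]
  rw [integral_const_mul]
  change ‖(c:ℂ)‖^2 * Mass d n f = 1
  have : ‖(c:ℂ)‖^2 = (Mass d n f)⁻¹ := by
    rw [Complex.norm_real, Real.norm_eq_abs, sq_abs]
    simp only [c]
    rw [inv_pow, Real.sq_sqrt hpos.le]
  rw [this, inv_mul_cancel₀ hpos.ne']

end BNLS

open BNLS in
/-- `‖Δ_y u_λ‖₂² → 0` as `λ → ∞` for minimizers `u_λ` of `m_{1,λ}`. -/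
theorem stmt_14 (d n : ℕ) (hd : 1 ≤ d) (hn : 1 ≤ n) (α : ℝ)
    (hα : 0 < α) (hα' : α < 8 / ((d:ℝ)+n))
    (u : ℝ → Pt d n → ℂ)
    (hu : ∀ lam : ℝ, 0 < lam →
      u lam ∈ Sset d n 1 ∧ Elam d n lam α (u lam) = m1lam d n lam α) :
    Tendsto (fun lam => lapYSq d n (u lam)) atTop (nhds 0) := by
  obtain ⟨C0, hC0⟩ := GN (d := d) (n := n) hd α hα hα'
  obtain ⟨v, hv, hvY⟩ := exists_test d n
  have hnn : ∀ w : Pt d n → ℂ, 0 ≤ lapYSq d n w := fun w =>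
    integral_nonneg fun z => by positivity
  have h2 : 0 < α + 2 := by linarith
  have hlow : ∀ w ∈ Sset d n 1, ∀ lam : ℝ,
      (lam - 1) / 2 * lapYSq d n w - C0 / (α+2) ≤ Elam d n lam α w := by
    intro w hw lam
    have h := hC0 w hw
    have h' : 1/(α+2) * Npow d n (α+2) w ≤ C0 / (α+2) + (lapXSq d n w + lapYSq d n w) / 2 := by
      calc 1/(α+2) * Npow d n (α+2) w
          ≤ 1/(α+2) * (C0 + (α+2)/2 * (lapXSq d n w + lapYSq d n w)) := by gcongr
        _ = _ := by field_simp
    unfold Elam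
    linarith
  set K : ℝ := 1/2 * lapXSq d n v - 1/(α+2) * Npow d n (α+2) v + C0 / (α+2) with hK
  have hup : ∀ lam : ℝ, 1 ≤ lam → (lam - 1) / 2 * lapYSq d n (u lam) ≤ K := by
    intro lam hl
    obtain ⟨h1, h3⟩ := hu lam (by linarith)
    have hb : BddBelow (Elam d n lam α '' Sset d n 1) := by
      refine ⟨- (C0 / (α+2)), ?_⟩
      rintro _ ⟨w, hw, rfl⟩
      have := hlow w hw lam
      have hp : 0 ≤ (lam - 1) / 2 * lapYSq d n w :=
        mul_nonneg (by linarith) (hnn w)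
      linarith
    have h4 : m1lam d n lam α ≤ Elam d n lam α v := csInf_le hb ⟨v, hv, rfl⟩
    have h5 := hlow _ h1 lam
    have h6 : Elam d n lam α v = 1/2 * lapXSq d n v - 1/(α+2) * Npow d n (α+2) v := by
      unfold Elam; rw [hvY]; ring
    linarith
  have hlim : Tendsto (fun lam : ℝ => K / ((lam - 1) / 2)) atTop (nhds 0) := by
    refine Tendsto.const_div_atTop ?_ K
    exact (tendsto_atTop_add_const_right _ (-1) tendsto_id).atTop_div_const two_pos
  refine tendsto_of_tendsto_of_tendsto_of_le_of_le' tendsto_const_nhds hlim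
    (.of_forall fun lam => hnn _) ?_
  filter_upwards [eventually_ge_atTop (2:ℝ)] with lam hl
  rw [le_div_iff₀ (by linarith)]
  have := hup lam (by linarith)
  linarith
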